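/- Let X be a set and k_in a positive definite kernel on X with double sum kernel k_0 and canonical pseudometric d_E(S,S') = sqrt(k_0(S,S) + k_0(S',S') − 2·k_0(S,S')) on S_fin(X). If d_E(S,S') > 0 for all S ≠ S' in S_fin(X) (i.e. d_E is a metric), then k_in satisfies condition (i). -/

import Mathlib

open scoped BigOperators

/-- The double sum kernel associated with a kernel `kin` on `X`, defined on finite subsets. -/
noncomputable def doubleSumKernel {X : Type*} (kin : X → X → ℝ) (S S' : Finset X) : ℝ :=
  (1 / ((S.card : ℝ) * (S'.card : ℝ))) * ∑ x ∈ S, ∑ x' ∈ S', kin x x'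

/-- The canonical distance associated with the double sum kernel. -/
noncomputable def dE {X : Type*} (kin : X → X → ℝ) (S S' : Finset X) : ℝ :=
  Real.sqrt (doubleSumKernel kin S S + doubleSumKernel kin S' S'
    - 2 * doubleSumKernel kin S S')

/-- Condition (i): for all `n₁, n₂ ≥ 1`, `ℓ ≤ min n₁ n₂` with `n := n₁ + n₂ - ℓ ≥ 2` and not
`(ℓ = n₁ ∧ ℓ = n₂)`, and all pairwise distinct `x₁, …, xₙ`, the corresponding quadratic form
with coefficients `1/n₁`, `1/n₁ - 1/n₂`, `-1/n₂` is positive. -/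
def CondI {X : Type*} (kin : X → X → ℝ) : Prop :=
  ∀ (n₁ n₂ ℓ : ℕ), 1 ≤ n₁ → 1 ≤ n₂ → ℓ ≤ min n₁ n₂ →
    2 ≤ n₁ + n₂ - ℓ → ¬(ℓ = n₁ ∧ ℓ = n₂) →
    ∀ (x : Fin (n₁ + n₂ - ℓ) → X), Function.Injective x →
      0 < ∑ i : Fin (n₁ + n₂ - ℓ), ∑ j : Fin (n₁ + n₂ - ℓ),
        (if (i : ℕ) < n₁ - ℓ then (1 : ℝ) / (n₁ : ℝ)
          else if (i : ℕ) < n₁ then 1 / (n₁ : ℝ) - 1 / (n₂ : ℝ) else -(1 / (n₂ : ℝ))) *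
        (if (j : ℕ) < n₁ - ℓ then (1 : ℝ) / (n₁ : ℝ)
          else if (j : ℕ) < n₁ then 1 / (n₁ : ℝ) - 1 / (n₂ : ℝ) else -(1 / (n₂ : ℝ))) *
        kin (x i) (x j)

/-- The weights of the uniform distribution on a finite set. -/
noncomputable def uniformWeight {ι : Type*} [DecidableEq ι] (A : Finset ι) (i : ι) : ℝ :=
  if i ∈ A then 1 / (A.card : ℝ) else 0

theorem doubleSumKernel_map {ι X : Type*} [Fintype ι] [DecidableEq ι] (kin : X → X → ℝ)
    (x : ι ↪ X) (A B : Finset ι) :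
    doubleSumKernel kin (A.map x) (B.map x) =
      ∑ i, ∑ j, uniformWeight A i * uniformWeight B j * kin (x i) (x j) := by
  simp only [doubleSumKernel, uniformWeight, Finset.sum_map, Finset.card_map, ite_mul, mul_ite,
    zero_mul, mul_zero, Finset.mul_sum]
  simp [mul_comm]

theorem sum_uniformWeight_sub_eq {ι X : Type*} [Fintype ι] [DecidableEq ι] (kin : X → X → ℝ)
    (hsymm : ∀ x y : X, kin x y = kin y x) (x : ι ↪ X) (A B : Finset ι) :
    ∑ i, ∑ j, (uniformWeight A i - uniformWeight B i) * (uniformWeight A j - uniformWeight B j) *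
        kin (x i) (x j) =
      doubleSumKernel kin (A.map x) (A.map x) + doubleSumKernel kin (B.map x) (B.map x)
        - 2 * doubleSumKernel kin (A.map x) (B.map x) := by
  have hcomm : ∑ i, ∑ j, uniformWeight B i * uniformWeight A j * kin (x i) (x j) =
      ∑ i, ∑ j, uniformWeight A i * uniformWeight B j * kin (x i) (x j) := by
    rw [Finset.sum_comm]
    refine Finset.sum_congr rfl fun i _ => Finset.sum_congr rfl fun j _ => ?_
    rw [hsymm]
    ring
  simp only [doubleSumKernel_map, sub_mul, mul_sub, Finset.sum_sub_distrib, hcomm]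
  ring

theorem card_filter_val_mem_Ico {n a b : ℕ} (hb : b ≤ n) :
    (Finset.univ.filter fun i : Fin n => a ≤ (i : ℕ) ∧ (i : ℕ) < b).card = b - a := by
  rw [← Nat.card_Ico, ← Finset.card_map Fin.valEmbedding]
  congr 1
  ext m
  simp only [Finset.mem_map, Finset.mem_filter, Finset.mem_univ, true_and, Fin.valEmbedding_apply,
    Finset.mem_Ico]
  exact ⟨by rintro ⟨i, hi, rfl⟩; exact hi, fun h => ⟨⟨m, by omega⟩, h, rfl⟩⟩

/-- if the canonical pseudometric `dE` of the double sum kernel of a positive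
definite kernel `kin` is a metric (i.e. positive on distinct nonempty finite subsets),
then `kin` satisfies condition (i). -/
theorem condI_of_dE_metric {X : Type*} (kin : X → X → ℝ)
    (hsymm : ∀ x y : X, kin x y = kin y x)
    (hpd : ∀ (n : ℕ) (t : Fin n → X) (a : Fin n → ℝ),
      0 ≤ ∑ i, ∑ j, a i * a j * kin (t i) (t j))
    (hmetric : ∀ S S' : Finset X, S.Nonempty → S'.Nonempty → S ≠ S' →
      0 < dE kin S S') :
    CondI kin := by
  intro n₁ n₂ ℓ h₁ h₂ hℓ _ hne
  generalize hn : n₁ + n₂ - ℓ = n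
  intro x hx
  set A : Finset (Fin n) := Finset.univ.filter fun i => 0 ≤ (i : ℕ) ∧ (i : ℕ) < n₁ with hA
  set B : Finset (Fin n) := Finset.univ.filter fun i => n₁ - ℓ ≤ (i : ℕ) ∧ (i : ℕ) < n with hB
  have hcA : A.card = n₁ := by rw [hA, card_filter_val_mem_Ico (by omega)]; omega
  have hcB : B.card = n₂ := by rw [hB, card_filter_val_mem_Ico le_rfl]; omega
  have hAB : A ≠ B := by
    intro h
    have hmem (i : Fin n) : (i : ℕ) < n₁ ↔ n₁ - ℓ ≤ (i : ℕ) := by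
      simpa [hA, hB] using Finset.ext_iff.mp h i
    have hlow := hmem ⟨0, by omega⟩
    have hhigh := hmem ⟨n - 1, by omega⟩
    simp only at hlow hhigh
    omega
  have hpos := Real.sqrt_pos.mp <| hmetric (A.map ⟨x, hx⟩) (B.map ⟨x, hx⟩)
    (by rw [Finset.map_nonempty, ← Finset.card_pos]; omega)
    (by rw [Finset.map_nonempty, ← Finset.card_pos]; omega)
    (fun h => hAB (Finset.map_injective _ h))
  rw [← sum_uniformWeight_sub_eq kin hsymm] at hpos
  have hcoef (i : Fin n) : uniformWeight A i - uniformWeight B i =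
      if (i : ℕ) < n₁ - ℓ then (1 : ℝ) / (n₁ : ℝ)
      else if (i : ℕ) < n₁ then 1 / (n₁ : ℝ) - 1 / (n₂ : ℝ) else -(1 / (n₂ : ℝ)) := by
    have hiA : i ∈ A ↔ (i : ℕ) < n₁ := by simp [hA]
    have hiB : i ∈ B ↔ ¬ (i : ℕ) < n₁ - ℓ := by simp [hB]
    simp only [uniformWeight, hcA, hcB, hiA, hiB]
    split_ifs <;> first | omega | simp
  simpa only [hcoef, Function.Embedding.coeFn_mk] using hpos
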